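/- Let λ ∈ k^c be nonzero and let M be a finitely generated left A-module. Then the map f ↦ f(u_λ) gives a k-linear isomorphism Hom_A(Au_λ, M) ≅ { m ∈ M : u_λ^{a−1} m = 0 }, and the map f ↦ f(u_λ^{a−1}) gives a k-linear isomorphism Hom_A(Au_λ^{a−1}, M) ≅ { m ∈ M : u_λ m = 0 }. -/

import Mathlib

open scoped TensorProduct

/-- The relations defining the quantum complete intersection `A^c_q`:
`x_i ^ a = 0` for all `i`, and `x_i x_j = q • x_j x_i` for `i < j`. -/
inductive QCIRel (k : Type) [Field k] (c a : ℕ) (q : k) :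
    FreeAlgebra k (Fin c) → FreeAlgebra k (Fin c) → Prop
  | pow (i : Fin c) : QCIRel k c a q (FreeAlgebra.ι k i ^ a) 0
  | comm (i j : Fin c) (hij : i < j) :
      QCIRel k c a q (FreeAlgebra.ι k i * FreeAlgebra.ι k j)
        (q • (FreeAlgebra.ι k j * FreeAlgebra.ι k i))

/-- The quantum complete intersection algebra `A^c_q = k⟨x_1,…,x_c⟩/(x_i^a, x_ix_j - q x_jx_i)`. -/
def QCI (k : Type) [Field k] (c a : ℕ) (q : k) : Type := RingQuot (QCIRel k c a q)

noncomputable instance (k : Type) [Field k] (c a : ℕ) (q : k) : Ring (QCI k c a q) :=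
  inferInstanceAs (Ring (RingQuot (QCIRel k c a q)))

noncomputable instance (k : Type) [Field k] (c a : ℕ) (q : k) : Algebra k (QCI k c a q) :=
  inferInstanceAs (Algebra k (RingQuot (QCIRel k c a q)))

namespace QCI

variable (k : Type) [Field k] (c a : ℕ) (q : k)

/-- The generators `x_i` of the quantum complete intersection. -/
noncomputable def x (i : Fin c) : QCI k c a q :=
  RingQuot.mkAlgHom k (QCIRel k c a q) (FreeAlgebra.ι k i)

/-- The element `u_λ = λ_1 x_1 + ⋯ + λ_c x_c` of `A^c_q`. -/
noncomputable def u (lam : Fin c → k) : QCI k c a q :=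
  ∑ i, lam i • QCI.x k c a q i

end QCI

/-- `a' = a / gcd(a, char k)` if `char k > 0`, and `a' = a` if `char k = 0`. -/
noncomputable def aprime (k : Type) [Field k] (a : ℕ) : ℕ :=
  if ringChar k > 0 then a / Nat.gcd a (ringChar k) else a

/-- Left multiplication by a ring element, as a `k`-linear map on a module. -/
noncomputable def smulLinearMap (k : Type) [CommRing k] {A : Type} [Ring A] [Algebra k A]
    (M : Type) [AddCommGroup M] [Module k M] [Module A M] [IsScalarTower k A M] (r : A) :
    M →ₗ[k] M where
  toFun m := r • m
  map_add' := smul_add r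
  map_smul' c m := (smul_comm c r m).symm

set_option synthInstance.maxHeartbeats 400000

/-- Gaussian binomial coefficients: `gaussCoeff q i j` is the `q`-binomial of `i + j` over `i`. -/
def gaussCoeff {k : Type*} [CommRing k] (q : k) : ℕ → ℕ → k
  | 0, _ => 1
  | _ + 1, 0 => 1
  | i + 1, j + 1 => q ^ (i + 1) * gaussCoeff q (i + 1) j + gaussCoeff q i (j + 1)

section GaussCoeff

variable {k : Type*} [CommRing k] (q : k)

@[simp] lemma gaussCoeff_zero_left (j : ℕ) : gaussCoeff q 0 j = 1 := by
  simp [gaussCoeff]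

@[simp] lemma gaussCoeff_zero_right (i : ℕ) : gaussCoeff q i 0 = 1 := by
  cases i <;> simp [gaussCoeff]

lemma gaussCoeff_succ_succ (i j : ℕ) : gaussCoeff q (i + 1) (j + 1) =
    q ^ (i + 1) * gaussCoeff q (i + 1) j + gaussCoeff q i (j + 1) := by
  simp [gaussCoeff]

lemma gaussCoeff_absorb (n : ℕ) : ∀ i j : ℕ, i + j = n →
    (1 - q ^ (i + 1)) * gaussCoeff q (i + 1) j = (1 - q ^ (i + j + 1)) * gaussCoeff q i j ∧
    (1 - q ^ (j + 1)) * gaussCoeff q i (j + 1) = (1 - q ^ (i + j + 1)) * gaussCoeff q i j := by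
  induction n with
  | zero =>
    intro i j h
    obtain ⟨rfl, rfl⟩ : i = 0 ∧ j = 0 := by omega
    simp
  | succ n ih =>
    intro i j h
    constructor
    · cases j with
      | zero => simp
      | succ j =>
        obtain ⟨h1, h2⟩ := ih i j (by omega)
        rw [gaussCoeff_succ_succ]
        linear_combination q ^ (i + 1) * h1 - q ^ (i + 1) * h2
    · cases i with
      | zero => simp
      | succ i =>
        obtain ⟨h1, h2⟩ := ih i j (by omega)
        rw [gaussCoeff_succ_succ]
        linear_combination h2 - h1

lemma pow_mul_of_mul_eq_smul_mul {B : Type*} [Ring B] [Algebra k B] {q : k} {X Y : B}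
    (h : X * Y = q • (Y * X)) (i : ℕ) : X * Y ^ i = q ^ i • (Y ^ i * X) := by
  induction i with
  | zero => simp
  | succ i ih =>
    rw [pow_succ, ← mul_assoc, ih, smul_mul_assoc, mul_assoc, h, mul_smul_comm, smul_smul,
      ← mul_assoc, pow_succ]

/-- The noncommutative `q`-binomial theorem. -/
lemma add_pow_of_mul_eq_smul_mul {B : Type*} [Ring B] [Algebra k B] {q : k} {X Y : B}
    (h : X * Y = q • (Y * X)) (n : ℕ) :
    (X + Y) ^ n = ∑ ij ∈ Finset.HasAntidiagonal.antidiagonal n,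
      gaussCoeff q ij.1 ij.2 • (Y ^ ij.1 * X ^ ij.2) := by
  induction n with
  | zero => simp
  | succ n ih =>
    have hX (i j : ℕ) : X * (gaussCoeff q i j • (Y ^ i * X ^ j)) =
        (q ^ i * gaussCoeff q i j) • (Y ^ i * X ^ (j + 1)) := by
      rw [mul_smul_comm, ← mul_assoc, pow_mul_of_mul_eq_smul_mul h, smul_mul_assoc, smul_smul,
        mul_assoc, ← pow_succ', mul_comm (gaussCoeff q i j)]
    have hY (i j : ℕ) : Y * (gaussCoeff q i j • (Y ^ i * X ^ j)) =
        gaussCoeff q i j • (Y ^ (i + 1) * X ^ j) := by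
      rw [mul_smul_comm, ← mul_assoc, ← pow_succ']
    rw [pow_succ', ih, add_mul, Finset.mul_sum, Finset.mul_sum]
    simp only [hX, hY]
    cases n with
    | zero => simp [Finset.Nat.antidiagonal_succ]
    | succ n =>
      rw [Finset.Nat.antidiagonal_succ_succ', Finset.Nat.sum_antidiagonal_succ,
        Finset.Nat.sum_antidiagonal_succ']
      simp only [Finset.sum_cons, Finset.sum_map, gaussCoeff_succ_succ, add_smul,
        Finset.sum_add_distrib, Function.Embedding.prodMap, Function.Embedding.coeFn_mk,
        Prod.map, gaussCoeff_zero_left, gaussCoeff_zero_right, Nat.succ_eq_add_one]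
      simp only [pow_zero, one_mul, mul_one, one_smul]
      abel

end GaussCoeff

lemma add_pow_of_isPrimitiveRoot {k B : Type*} [Field k] [Ring B] [Algebra k B] {q : k} {m : ℕ}
    (hm : 0 < m) (hq : IsPrimitiveRoot q m) {X Y : B} (h : X * Y = q • (Y * X)) :
    (X + Y) ^ m = X ^ m + Y ^ m := by
  have hzero (i j : ℕ) (hij : i + 1 + (j + 1) = m) : gaussCoeff q (i + 1) (j + 1) = 0 := by
    have h1 := (gaussCoeff_absorb q _ i (j + 1) rfl).1
    rw [show i + (j + 1) + 1 = m by omega, hq.pow_eq_one, sub_self, zero_mul] at h1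
    refine (mul_eq_zero.mp h1).resolve_left fun h0 => ?_
    exact hq.pow_ne_one_of_pos_of_lt (by omega) (by omega) (sub_eq_zero.mp h0).symm
  rw [add_pow_of_mul_eq_smul_mul h]
  rcases m with _ | _ | n
  · omega
  · simp [Finset.Nat.antidiagonal_succ]
  · rw [Finset.Nat.antidiagonal_succ_succ']
    simp only [Finset.sum_cons, Finset.sum_map]
    rw [Finset.sum_eq_zero]
    · simp
    · rintro ⟨i, j⟩ hij
      rw [Finset.HasAntidiagonal.mem_antidiagonal] at hij
      simp only at hij
      simp [hzero i j (by omega)]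

lemma add_pow_eq_zero_of_isPrimitiveRoot_aprime {k : Type} {B : Type*} [Field k] [Ring B]
    [Algebra k B] {q : k} {a : ℕ} (ha : 0 < a) (hq : IsPrimitiveRoot q (aprime k a)) {X Y : B}
    (h : X * Y = q • (Y * X)) (hX : X ^ a = 0) (hY : Y ^ a = 0) : (X + Y) ^ a = 0 := by
  rcases subsingleton_or_nontrivial B with hB | hB
  · exact Subsingleton.elim _ _
  rcases (CharP.char_is_prime_or_zero k (ringChar k)) with hp | hp
  · have key : aprime k a = a / Nat.gcd a (ringChar k) := by simp [aprime, hp.pos]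
    rw [key] at hq
    rcases (Nat.coprime_or_dvd_of_prime hp a) with hc | hd
    · rw [Nat.gcd_comm, hc, Nat.div_one] at hq
      rw [add_pow_of_isPrimitiveRoot ha hq h, hX, hY, add_zero]
    · rw [Nat.gcd_eq_right hd] at hq
      set p := ringChar k with hpdef
      obtain ⟨m, rfl⟩ := hd
      rw [Nat.mul_div_cancel_left _ hp.pos] at hq
      have hm : 0 < m := Nat.pos_of_mul_pos_left ha
      have : Fact p.Prime := ⟨hp⟩
      have : CharP B p := charP_of_injective_algebraMap (algebraMap k B).injective p
      have hcomm : Commute (X ^ m) (Y ^ m) := by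
        have h1 : Commute X (Y ^ m) := by
          rw [Commute, SemiconjBy, pow_mul_of_mul_eq_smul_mul h, hq.pow_eq_one, one_smul]
        exact h1.pow_left m
      rw [mul_comm p m, pow_mul, add_pow_of_isPrimitiveRoot hm hq h,
        add_pow_char_of_commute _ hcomm, ← pow_mul, ← pow_mul, mul_comm m p, hX, hY, add_zero]
  · have key : aprime k a = a := by simp [aprime, hp]
    rw [key] at hq
    rw [add_pow_of_isPrimitiveRoot ha hq h, hX, hY, add_zero]

lemma sum_pow_eq_zero_of_isPrimitiveRoot_aprime {k : Type} {B ι : Type*} [Field k] [Ring B]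
    [Algebra k B] [LinearOrder ι] {q : k} {a : ℕ} (ha : 0 < a)
    (hq : IsPrimitiveRoot q (aprime k a)) {Y : ι → B}
    (h : ∀ i j, i < j → Y i * Y j = q • (Y j * Y i)) (hY : ∀ i, Y i ^ a = 0) (s : Finset ι) :
    (∑ i ∈ s, Y i) ^ a = 0 := by
  induction s using Finset.induction_on_max with
  | empty => simp [ha.ne']
  | insert j s hs ih =>
    rw [Finset.sum_insert fun hj => (hs j hj).false, add_comm]
    refine add_pow_eq_zero_of_isPrimitiveRoot_aprime ha hq ?_ ih (hY j)
    rw [Finset.sum_mul, Finset.mul_sum, Finset.smul_sum]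
    exact Finset.sum_congr rfl fun i hi => h i j (hs i hi)

namespace Matrix

variable {k A : Type*} [CommRing k] [Ring A] [Algebra k A] {a : ℕ}

/-- The nilpotent Jordan block with ones on the superdiagonal. -/
def superShift (A : Type*) [Ring A] (a : ℕ) : Matrix (Fin a) (Fin a) A :=
  Matrix.of fun i j => if (i : ℕ) + 1 = j then 1 else 0

/-- The diagonal matrix with entries `d ^ n • y`. -/
def geomDiagonal (a : ℕ) (d : k) (y : A) : Matrix (Fin a) (Fin a) A :=
  Matrix.diagonal fun n => d ^ (n : ℕ) • y

lemma superShift_apply (i j : Fin a) :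
    superShift A a i j = if (i : ℕ) + 1 = j then 1 else 0 := rfl

lemma superShift_pow_apply (r : ℕ) (i j : Fin a) :
    (superShift A a ^ r) i j = if (i : ℕ) + r = j then 1 else 0 := by
  induction r generalizing i j with
  | zero => simp [Matrix.one_apply, Fin.ext_iff]
  | succ r ih =>
    rw [pow_succ, Matrix.mul_apply]
    simp only [ih, superShift_apply, mul_ite, mul_one, mul_zero]
    by_cases h : (i : ℕ) + (r + 1) = j
    · rw [Finset.sum_eq_single ⟨i + r, by omega⟩]
      · simp [h, add_assoc]
      · intro l _ hl
        have : (i : ℕ) + r ≠ l := fun h' => hl (Fin.ext h'.symm)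
        simp [this]
      · simp
    · rw [if_neg h]
      refine Finset.sum_eq_zero fun l _ => ?_
      split_ifs <;> first | rfl | omega

lemma superShift_pow_eq_zero : superShift A a ^ a = 0 := by
  ext i j
  rw [superShift_pow_apply, if_neg (by omega), Matrix.zero_apply]

lemma mul_superShift_apply (P : Matrix (Fin a) (Fin a) A) (i j l : Fin a)
    (h : (j : ℕ) + 1 = l) : (P * superShift A a) i l = P i j := by
  rw [Matrix.mul_apply, Finset.sum_eq_single j]
  · simp [superShift, h]
  · intro b _ hb
    have : (b : ℕ) + 1 ≠ l := fun h' => hb (Fin.ext (by omega))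
    simp [superShift, this]
  · simp

lemma geomDiagonal_mul (d e : k) (y z : A) :
    geomDiagonal a d y * geomDiagonal a e z = geomDiagonal a (d * e) (y * z) := by
  simp [geomDiagonal, Matrix.diagonal_mul_diagonal, smul_smul, mul_pow, mul_comm]

lemma geomDiagonal_smul (r d : k) (y : A) :
    geomDiagonal a d (r • y) = r • geomDiagonal a d y := by
  ext i j
  by_cases h : i = j <;> simp [geomDiagonal, h, smul_comm r]

lemma geomDiagonal_pow {n : ℕ} (d : k) {y : A} (hy : y ^ n = 0) :
    geomDiagonal a d y ^ n = 0 := by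
  ext i j
  simp [geomDiagonal, Matrix.diagonal_pow, smul_pow, hy, Matrix.diagonal_apply]

lemma superShift_mul_geomDiagonal (d : k) (y : A) :
    superShift A a * geomDiagonal a d y = d • (geomDiagonal a d y * superShift A a) := by
  ext i j
  rw [geomDiagonal, Matrix.mul_diagonal, Matrix.smul_apply, Matrix.diagonal_mul]
  by_cases h : (i : ℕ) + 1 = j
  · simp [superShift, h.symm, pow_succ', smul_smul]
  · simp [superShift, h]

end Matrix

namespace QCI

open Matrix

variable {k : Type} [Field k] {c a : ℕ} {q : k}

lemma x_pow (i : Fin c) : x k c a q i ^ a = 0 := by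
  have := RingQuot.mkAlgHom_rel k (QCIRel.pow (k := k) (c := c) (a := a) (q := q) i)
  rw [map_pow, map_zero] at this
  exact this

lemma x_mul_x {i j : Fin c} (hij : i < j) :
    x k c a q i * x k c a q j = q • (x k c a q j * x k c a q i) := by
  have := RingQuot.mkAlgHom_rel k (QCIRel.comm (k := k) (c := c) (a := a) (q := q) i j hij)
  rw [map_smul, map_mul, map_mul] at this
  exact this

/-- The algebra map out of `QCI` determined by elements satisfying the defining relations. -/
noncomputable def lift {B : Type*} [Ring B] [Algebra k B] (X : Fin c → B) (hpow : ∀ i, X i ^ a = 0)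
    (hcomm : ∀ i j, i < j → X i * X j = q • (X j * X i)) : QCI k c a q →ₐ[k] B :=
  RingQuot.liftAlgHom k ⟨FreeAlgebra.lift k X, by
    intro y z h
    induction h with
    | pow i => simp [hpow]
    | comm i j hij => simp [hcomm i j hij]⟩

@[simp] lemma lift_x {B : Type*} [Ring B] [Algebra k B] (X : Fin c → B)
    (hpow : ∀ i, X i ^ a = 0) (hcomm : ∀ i j, i < j → X i * X j = q • (X j * X i)) (i : Fin c) :
    lift X hpow hcomm (x k c a q i) = X i :=
  (RingQuot.liftAlgHom_mkAlgHom_apply k _ _ _).trans (FreeAlgebra.lift_ι_apply _ _)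

@[elab_as_elim]
lemma induction {P : QCI k c a q → Prop} (hk : ∀ r : k, P (algebraMap k _ r))
    (hx : ∀ i, P (x k c a q i)) (hmul : ∀ y z, P y → P z → P (y * z))
    (hadd : ∀ y z, P y → P z → P (y + z)) (y : QCI k c a q) : P y := by
  obtain ⟨w, rfl⟩ := RingQuot.mkAlgHom_surjective k (QCIRel k c a q) y
  induction w using FreeAlgebra.induction with
  | grade0 r => rw [AlgHom.commutes]; exact hk r
  | grade1 i => exact hx i
  | mul y z hy hz => rw [map_mul]; exact hmul _ _ hy hz
  | add y z hy hz => rw [map_add]; exact hadd _ _ hy hz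

lemma u_pow (ha : 0 < a) (hq : IsPrimitiveRoot q (aprime k a)) (lam : Fin c → k) :
    u k c a q lam ^ a = 0 := by
  refine sum_pow_eq_zero_of_isPrimitiveRoot_aprime ha hq (fun i j hij => ?_) (fun i => ?_) _
  · simp only [smul_mul_smul_comm, x_mul_x hij, smul_smul]
    congr 1
    ring
  · rw [smul_pow, x_pow, smul_zero]

/-- The scalar by which the new variable passes `x_j` when it is adjoined next to `x_i`. -/
def twist (q : k) (i j : Fin c) : k := if j < i then q⁻¹ else q

/-- The images of the generators under the `q`-translation of the variable `x_i`: the matrices of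
right multiplication by `x_j`, and by `x_i + r t` for `j = i`, on `⨁ A t ^ n`. -/
noncomputable def translateGen (k : Type) [Field k] (c a : ℕ) (q : k) (i : Fin c) (r : k)
    (j : Fin c) : Matrix (Fin a) (Fin a) (QCI k c a q) :=
  (if j = i then r else 0) • superShift _ a + geomDiagonal a (twist q i j) (x k c a q j)

lemma translateGen_pow (ha : 0 < a) (hq : IsPrimitiveRoot q (aprime k a)) (i : Fin c) (r : k)
    (j : Fin c) : translateGen k c a q i r j ^ a = 0 := by
  rcases eq_or_ne j i with rfl | h
  · refine add_pow_eq_zero_of_isPrimitiveRoot_aprime ha hq ?_ ?_ (geomDiagonal_pow _ (x_pow _))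
    · rw [smul_mul_assoc, superShift_mul_geomDiagonal, mul_smul_comm, smul_comm]
      simp [twist]
    · rw [smul_pow, superShift_pow_eq_zero, smul_zero]
  · simp [translateGen, h, geomDiagonal_pow _ (x_pow j)]

lemma translateGen_comm (hq : q ≠ 0) (i : Fin c) (r : k) (j l : Fin c) (hjl : j < l) :
    translateGen k c a q i r j * translateGen k c a q i r l =
      q • (translateGen k c a q i r l * translateGen k c a q i r j) := by
  have hdiag : geomDiagonal a (twist q i j) (x k c a q j) *
      geomDiagonal a (twist q i l) (x k c a q l) = q • (geomDiagonal a (twist q i l) (x k c a q l) *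
      geomDiagonal a (twist q i j) (x k c a q j)) := by
    rw [geomDiagonal_mul, geomDiagonal_mul, x_mul_x hjl, geomDiagonal_smul, mul_comm]
  rcases eq_or_ne j i with rfl | hj
  · simp only [translateGen, if_pos, if_neg hjl.ne', zero_smul, zero_add, add_mul, mul_add,
      hdiag, smul_add, smul_mul_assoc, mul_smul_comm, superShift_mul_geomDiagonal]
    simp [twist, hjl.not_gt, smul_comm q r]
  rcases eq_or_ne l i with rfl | hl
  · simp only [translateGen, if_pos, if_neg hj, zero_smul, zero_add, add_mul, mul_add,
      hdiag, smul_add, smul_mul_assoc, mul_smul_comm, superShift_mul_geomDiagonal]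
    simp [twist, hjl, smul_smul, mul_left_comm q r, hq]
  · simp [translateGen, hj, hl, hdiag]

/-- The `q`-translation `x_i ↦ x_i + r t`, as a matrix representation. -/
noncomputable def translate (ha : 0 < a) (hq : IsPrimitiveRoot q (aprime k a)) (hq0 : q ≠ 0)
    (i : Fin c) (r : k) : QCI k c a q →ₐ[k] Matrix (Fin a) (Fin a) (QCI k c a q) :=
  lift (translateGen k c a q i r) (translateGen_pow ha hq i r) (translateGen_comm hq0 i r)

lemma translate_mulVec_single (ha : 0 < a) (hq : IsPrimitiveRoot q (aprime k a)) (hq0 : q ≠ 0)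
    (i : Fin c) (r : k) (y z : QCI k c a q) :
    translate ha hq hq0 i r y *ᵥ Pi.single ⟨0, ha⟩ z = Pi.single ⟨0, ha⟩ (y * z) := by
  induction y using QCI.induction generalizing z with
  | hk s =>
    rw [AlgHom.commutes, Algebra.algebraMap_eq_smul_one, Matrix.smul_mulVec, Matrix.one_mulVec,
      ← Algebra.smul_def, Pi.single_smul]
  | hx j =>
    rw [translate, lift_x]
    ext n
    rw [Matrix.mulVec_single]
    by_cases hn : n = ⟨0, ha⟩
    · subst hn
      by_cases hj : j = i <;> simp [translateGen, superShift_apply, geomDiagonal, hj]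
    · by_cases hj : j = i <;> simp [translateGen, superShift_apply, geomDiagonal, hj, hn]
  | hmul y y' hy hy' => rw [map_mul, ← Matrix.mulVec_mulVec, hy', hy, mul_assoc]
  | hadd y y' hy hy' => rw [map_add, Matrix.add_mulVec, hy, hy', ← Pi.single_add, add_mul]

lemma translate_apply_zero_zero (ha : 0 < a) (hq : IsPrimitiveRoot q (aprime k a)) (hq0 : q ≠ 0)
    (i : Fin c) (r : k) (y : QCI k c a q) :
    translate ha hq hq0 i r y ⟨0, ha⟩ ⟨0, ha⟩ = y := by
  have := congrFun (translate_mulVec_single ha hq hq0 i r y 1) ⟨0, ha⟩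
  simpa using this

lemma translate_u (ha : 0 < a) (hq : IsPrimitiveRoot q (aprime k a)) (hq0 : q ≠ 0)
    {lam : Fin c → k} {i : Fin c} (hi : lam i ≠ 0) (hlt : ∀ j < i, lam j = 0) :
    translate ha hq hq0 i (lam i)⁻¹ (u k c a q lam) =
      superShift _ a + geomDiagonal a q (u k c a q lam) := by
  have hg : geomDiagonal a q (u k c a q lam) =
      ∑ j, lam j • geomDiagonal a (twist q i j) (x k c a q j) := by
    have h1 (j : Fin c) : lam j • geomDiagonal a (twist q i j) (x k c a q j) =
        lam j • geomDiagonal a q (x k c a q j) := by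
      by_cases hj : j < i
      · simp [hlt j hj]
      · simp [twist, hj]
    simp only [h1]
    ext m n
    by_cases h : m = n
    · simp [geomDiagonal, h, u, Matrix.sum_apply, Finset.smul_sum, smul_comm (q ^ (n : ℕ))]
    · simp [geomDiagonal, h, Matrix.sum_apply]
  rw [hg]
  simp only [u, map_sum, map_smul, translate, lift_x, translateGen, smul_add,
    Finset.sum_add_distrib]
  simp [smul_smul, hi]

lemma exists_eq_mul_u_pow (ha : 0 < a) (hq : IsPrimitiveRoot q (aprime k a)) (hq0 : q ≠ 0)
    {lam : Fin c → k} (hlam : lam ≠ 0) {y : QCI k c a q} (hy : y * u k c a q lam = 0) :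
    ∃ z, y = z * u k c a q lam ^ (a - 1) := by
  obtain ⟨i, hi, hlt⟩ : ∃ i, lam i ≠ 0 ∧ ∀ j < i, lam j = 0 := by
    obtain ⟨i, hi⟩ := Function.ne_iff.mp hlam
    obtain ⟨j, hj, hmin⟩ := wellFounded_lt.has_min {i | lam i ≠ 0} ⟨i, hi⟩
    exact ⟨j, hj, fun l hl => by_contra fun h => hmin l h hl⟩
  have hmul := congrArg (translate ha hq hq0 i (lam i)⁻¹) hy
  rw [map_mul, map_zero, translate_u ha hq hq0 hi hlt, mul_add] at hmul
  set P := translate ha hq hq0 i (lam i)⁻¹ y with hP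
  have hstep (n m : Fin a) (hnm : (n : ℕ) + 1 = m) :
      P ⟨0, ha⟩ n = (-(q ^ (m : ℕ)) • P ⟨0, ha⟩ m) * u k c a q lam := by
    have h1 := congrFun (congrFun hmul ⟨0, ha⟩) m
    rw [Matrix.add_apply, mul_superShift_apply _ _ _ _ hnm, geomDiagonal, Matrix.mul_diagonal,
      Matrix.zero_apply, mul_smul_comm] at h1
    rw [smul_mul_assoc, neg_smul]
    exact eq_neg_of_add_eq_zero_left h1
  have hall (n : ℕ) (hn : n < a) : ∃ z, y = z * u k c a q lam ^ n ∧
      ∃ s : k, z = s • P ⟨0, ha⟩ ⟨n, hn⟩ := by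
    induction n with
    | zero => exact ⟨y, by simp, 1, by rw [one_smul, hP, translate_apply_zero_zero]⟩
    | succ n ih =>
      obtain ⟨z, hz, s, rfl⟩ := ih (by omega)
      refine ⟨_, ?_, s * -(q ^ (n + 1)), rfl⟩
      rw [hz, hstep ⟨n, by omega⟩ ⟨n + 1, hn⟩ rfl, pow_succ' (u k c a q lam), ← mul_assoc,
        mul_smul]
      simp only [smul_mul_assoc]
  obtain ⟨z, hz, -⟩ := hall (a - 1) (by omega)
  exact ⟨z, hz⟩

end QCI

/-- If the left annihilator of a nilpotent element `u` with `u ^ a = 0` is generated by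
`u ^ (a - 1)`, then the left annihilator of `u ^ (a - 1)` is generated by `u`. -/
lemma exists_eq_mul_of_mul_pow_eq_zero {A : Type*} [Ring A] {u : A} {a : ℕ}
    (h : ∀ y, y * u = 0 → ∃ z, y = z * u ^ (a - 1)) (j : ℕ) (hj : j < a) (y : A)
    (hy : y * u ^ j = 0) : ∃ z, y = z * u := by
  induction j generalizing y with
  | zero => exact ⟨0, by simpa using hy⟩
  | succ j ih =>
    obtain ⟨z, hz⟩ := h (y * u ^ j) (by rw [mul_assoc, ← pow_succ, hy])
    obtain ⟨w, hw⟩ := ih (by omega) (y - z * u ^ (a - 1 - j)) (by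
      rw [sub_mul, hz, mul_assoc, ← pow_add, Nat.sub_add_cancel (by omega), sub_self])
    refine ⟨w + z * u ^ (a - 1 - j - 1), ?_⟩
    rw [add_mul, ← hw, mul_assoc, ← pow_succ, Nat.sub_add_cancel (by omega), sub_add_cancel]

lemma exists_hom_span_singleton_equiv_ker {k A M : Type} [Field k] [Ring A] [Algebra k A]
    [AddCommGroup M] [Module k M] [Module A M] [IsScalarTower k A M] {u v : A} (hvu : v * u = 0)
    (h : ∀ y, y * u = 0 → ∃ z, y = z * v) :
    ∃ e : ((Submodule.span A {u}) →ₗ[A] M) ≃ₗ[k] (LinearMap.ker (smulLinearMap k M v)),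
      ∀ f, (e f : M) = f ⟨u, Submodule.mem_span_singleton_self _⟩ := by
  let ev : ((Submodule.span A {u}) →ₗ[A] M) →ₗ[k] (LinearMap.ker (smulLinearMap k M v)) :=
    { toFun f := ⟨f ⟨u, Submodule.mem_span_singleton_self _⟩, by
        change v • f _ = 0
        rw [← map_smul]
        have : v • (⟨u, Submodule.mem_span_singleton_self _⟩ : Submodule.span A {u}) = 0 :=
          Subtype.ext hvu
        rw [this, map_zero]⟩
      map_add' _ _ := rfl
      map_smul' _ _ := rfl }
  refine ⟨LinearEquiv.ofBijective ev ⟨fun f g hfg => ?_, fun m => ?_⟩, fun _ => rfl⟩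
  · have h1 : f ⟨u, Submodule.mem_span_singleton_self _⟩ =
        g ⟨u, Submodule.mem_span_singleton_self _⟩ := congrArg Subtype.val hfg
    ext ⟨y, hy⟩
    obtain ⟨r, rfl⟩ := Submodule.mem_span_singleton.mp hy
    have h2 := congrArg (r • ·) h1
    simp only [← map_smul] at h2
    exact h2
  · have hm : v • (m : M) = 0 := m.2
    have hann (r : A) (hr : r • u = 0) : r • (m : M) = 0 := by
      obtain ⟨z, rfl⟩ := h r hr
      rw [mul_smul, hm, smul_zero]
    refine ⟨(LinearPMap.mkSpanSingleton' (σ := RingHom.id A) u (m : M) hann).toFun, Subtype.ext ?_⟩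
    exact LinearPMap.mkSpanSingleton'_apply_self (σ := RingHom.id A) u (m : M) hann _

/-- For nonzero `λ ∈ k^c` and a finitely generated left `A`-module `M`, evaluation `f ↦ f(u_λ)`
is a `k`-linear isomorphism `Hom_A(Au_λ, M) ≅ {m ∈ M : u_λ^{a-1} m = 0}`, and evaluation
`f ↦ f(u_λ^{a-1})` is a `k`-linear isomorphism `Hom_A(Au_λ^{a-1}, M) ≅ {m ∈ M : u_λ m = 0}`. -/
theorem hom_span_uLam_equiv_ker (k : Type) [Field k] [IsAlgClosed k] (a c : ℕ)
    (ha : 2 ≤ a) (hc : 1 ≤ c) (q : k) (hq : IsPrimitiveRoot q (aprime k a))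
    (lam : Fin c → k) (hlam : lam ≠ 0)
    (M : Type) [AddCommGroup M] [Module k M] [Module (QCI k c a q) M]
    [IsScalarTower k (QCI k c a q) M] [Module.Finite (QCI k c a q) M] :
    (∃ e : ((Submodule.span (QCI k c a q) {QCI.u k c a q lam}) →ₗ[QCI k c a q] M)
        ≃ₗ[k] (LinearMap.ker (smulLinearMap k M (QCI.u k c a q lam ^ (a - 1)))),
      ∀ f, (e f : M) = f ⟨QCI.u k c a q lam, Submodule.mem_span_singleton_self _⟩) ∧
    (∃ e : ((Submodule.span (QCI k c a q) {QCI.u k c a q lam ^ (a - 1)}) →ₗ[QCI k c a q] M)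
        ≃ₗ[k] (LinearMap.ker (smulLinearMap k M (QCI.u k c a q lam))),
      ∀ f, (e f : M) = f ⟨QCI.u k c a q lam ^ (a - 1), Submodule.mem_span_singleton_self _⟩) := by
  have ha0 : 0 < a := by omega
  have ha' : aprime k a ≠ 0 := by
    unfold aprime
    split_ifs
    · exact (Nat.div_pos (Nat.gcd_le_left _ ha0) (Nat.gcd_pos_of_pos_left _ ha0)).ne'
    · exact ha0.ne'
  have hq0 : q ≠ 0 := hq.ne_zero ha'
  have hu := QCI.u_pow ha0 hq lam
  have hann (y : QCI k c a q) (hy : y * QCI.u k c a q lam = 0) :=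
    QCI.exists_eq_mul_u_pow ha0 hq hq0 hlam hy
  constructor
  · refine exists_hom_span_singleton_equiv_ker ?_ hann
    rw [← pow_succ, Nat.sub_add_cancel ha0, hu]
  · refine exists_hom_span_singleton_equiv_ker ?_
      (exists_eq_mul_of_mul_pow_eq_zero hann (a - 1) (by omega))
    rw [← pow_succ', Nat.sub_add_cancel ha0, hu]
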